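/- arXiv:1512.00404 — 2 statements merged into one kernel-verified Lean document; each statement's English description precedes it below -/
import Mathlib

section
/- Let M be an intra-regular po-Γ-semigroup. If the ideals of M form a chain (i.e., for any two ideals A, B of M, A ⊆ B or B ⊆ A) then, for every x, y ∈ M and every γ ∈ Γ, we have x ∈ (MΓ{xγy}ΓM] or y ∈ (MΓ{xγy}ΓM]. -/
namespace PGS

variable {M : Type*} {Γ : Type*}

/-- `AΓB = {aγb : a ∈ A, b ∈ B, γ ∈ Γ}`. -/
def gprod (op : Γ → M → M → M) (A B : Set M) : Set M :=
  {x | ∃ a ∈ A, ∃ b ∈ B, ∃ γ : Γ, x = op γ a b}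

/-- `(H] = {t : t ≤ h for some h ∈ H}`. -/
def dcl [PartialOrder M] (H : Set M) : Set M :=
  {t | ∃ h ∈ H, t ≤ h}

/-- `M` with the family of operations `op : Γ → M → M → M` and the partial order `≤`
is a po-Γ-semigroup: `(aγb)μc = aγ(bμc)` and the order is compatible with the operations. -/
def IsPoGammaSemigroup [PartialOrder M] (op : Γ → M → M → M) : Prop :=
  (∀ (a b c : M) (γ μ : Γ), op μ (op γ a b) c = op γ a (op μ b c)) ∧
  (∀ (a b c : M) (γ : Γ), a ≤ b → op γ a c ≤ op γ b c) ∧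
  (∀ (a b c : M) (γ : Γ), a ≤ b → op γ c a ≤ op γ c b)

/-- Left ideal of `M`: `MΓA ⊆ A` and `A` is downward closed. -/
def IsLeftIdeal [PartialOrder M] (op : Γ → M → M → M) (A : Set M) : Prop :=
  gprod op Set.univ A ⊆ A ∧ ∀ a ∈ A, ∀ b : M, b ≤ a → b ∈ A

/-- Right ideal of `M`: `AΓM ⊆ A` and `A` is downward closed. -/
def IsRightIdeal [PartialOrder M] (op : Γ → M → M → M) (A : Set M) : Prop :=
  gprod op A Set.univ ⊆ A ∧ ∀ a ∈ A, ∀ b : M, b ≤ a → b ∈ A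

/-- Ideal of `M`: both a left and a right ideal. -/
def IsIdeal [PartialOrder M] (op : Γ → M → M → M) (A : Set M) : Prop :=
  IsLeftIdeal op A ∧ IsRightIdeal op A

/-- A prime subset: `aγb ∈ T` implies `a ∈ T` or `b ∈ T`. -/
def IsPrimeSubset (op : Γ → M → M → M) (T : Set M) : Prop :=
  ∀ (a b : M) (γ : Γ), op γ a b ∈ T → a ∈ T ∨ b ∈ T

/-- A semiprime subset: `aγa ∈ T` implies `a ∈ T`. -/
def IsSemiprimeSubset (op : Γ → M → M → M) (T : Set M) : Prop :=
  ∀ (a : M) (γ : Γ), op γ a a ∈ T → a ∈ T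

/-- A weakly prime subset: for all ideals `A`, `B` of `M` with `AΓB ⊆ T`,
`A ⊆ T` or `B ⊆ T`. -/
def IsWeaklyPrimeSubset [PartialOrder M] (op : Γ → M → M → M) (T : Set M) : Prop :=
  ∀ A B : Set M, IsIdeal op A → IsIdeal op B → gprod op A B ⊆ T → A ⊆ T ∨ B ⊆ T

/-- Intra-regular: `x ∈ (MΓ{xγx}ΓM]` for all `x`, `γ`. -/
def IsIntraRegular [PartialOrder M] (op : Γ → M → M → M) : Prop :=
  ∀ (x : M) (γ : Γ),
    x ∈ dcl (gprod op (gprod op Set.univ {op γ x x}) Set.univ)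

/-- Left regular: `x ∈ (MΓ{xγx}]` for all `x`, `γ`. -/
def IsLeftRegular [PartialOrder M] (op : Γ → M → M → M) : Prop :=
  ∀ (x : M) (γ : Γ), x ∈ dcl (gprod op Set.univ {op γ x x})

/-- Left duo: every left ideal of `M` is an ideal of `M`. -/
def IsLeftDuo [PartialOrder M] (op : Γ → M → M → M) : Prop :=
  ∀ A : Set M, IsLeftIdeal op A → IsIdeal op A

/-- A subsemigroup: a nonempty subset `T` with `TΓT ⊆ T`. -/
def IsSubsemigroup (op : Γ → M → M → M) (T : Set M) : Prop :=
  T.Nonempty ∧ gprod op T T ⊆ T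

/-- An ideal of a subsemigroup `T`: a nonempty subset `I` of `T` with `TΓI ⊆ I`,
`IΓT ⊆ I`, closed downward inside `T`. -/
def IsIdealOfSub [PartialOrder M] (op : Γ → M → M → M) (T I : Set M) : Prop :=
  I.Nonempty ∧ I ⊆ T ∧ gprod op T I ⊆ I ∧ gprod op I T ⊆ I ∧
    ∀ a ∈ I, ∀ b ∈ T, b ≤ a → b ∈ I

/-- A left ideal of a subsemigroup `T`: a nonempty subset `I` of `T` with `TΓI ⊆ I`,
closed downward inside `T`. -/
def IsLeftIdealOfSub [PartialOrder M] (op : Γ → M → M → M) (T I : Set M) : Prop :=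
  I.Nonempty ∧ I ⊆ T ∧ gprod op T I ⊆ I ∧ ∀ a ∈ I, ∀ b ∈ T, b ≤ a → b ∈ I

/-- A simple subsemigroup: a subsemigroup having no ideal other than itself. -/
def IsSimpleSub [PartialOrder M] (op : Γ → M → M → M) (T : Set M) : Prop :=
  IsSubsemigroup op T ∧ ∀ I : Set M, IsIdealOfSub op T I → I = T

/-- A left simple subsemigroup: a subsemigroup having no left ideal other than itself. -/
def IsLeftSimpleSub [PartialOrder M] (op : Γ → M → M → M) (T : Set M) : Prop :=
  IsSubsemigroup op T ∧ ∀ I : Set M, IsLeftIdealOfSub op T I → I = T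

/-- A filter of `M`: a subsemigroup `F` such that `aγb ∈ F` implies `a ∈ F` and `b ∈ F`,
and `F` is upward closed. -/
def IsFilterSub [PartialOrder M] (op : Γ → M → M → M) (F : Set M) : Prop :=
  IsSubsemigroup op F ∧ (∀ (a b : M) (γ : Γ), op γ a b ∈ F → a ∈ F ∧ b ∈ F) ∧
    ∀ a ∈ F, ∀ c : M, a ≤ c → c ∈ F

/-- `N(x)`: the least filter of `M` containing `x`. -/
def Nfil [PartialOrder M] (op : Γ → M → M → M) (x : M) : Set M :=
  ⋂₀ {F : Set M | IsFilterSub op F ∧ x ∈ F}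

/-- The `𝒩`-class `(x)_𝒩` of `x`, where `a 𝒩 b` iff `N(a) = N(b)`. -/
def Ncls [PartialOrder M] (op : Γ → M → M → M) (x : M) : Set M :=
  {y | Nfil op y = Nfil op x}

/-- `L(a) = ({a} ∪ MΓ{a}]`, the left ideal of `M` generated by `a`. -/
def Lgen [PartialOrder M] (op : Γ → M → M → M) (a : M) : Set M :=
  dcl ({a} ∪ gprod op Set.univ {a})

/-- `I(a) = ({a} ∪ MΓ{a} ∪ {a}ΓM ∪ MΓ{a}ΓM]`, the ideal of `M` generated by `a`. -/
def Igen [PartialOrder M] (op : Γ → M → M → M) (a : M) : Set M :=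
  dcl ({a} ∪ gprod op Set.univ {a} ∪ gprod op {a} Set.univ ∪
    gprod op (gprod op Set.univ {a}) Set.univ)

/-- A semilattice congruence on `M`. -/
def IsSemilatticeCong (op : Γ → M → M → M) (σ : M → M → Prop) : Prop :=
  Equivalence σ ∧
  (∀ (a b c : M) (γ : Γ), σ a b → σ (op γ a c) (op γ b c)) ∧
  (∀ (a b c : M) (γ : Γ), σ a b → σ (op γ c a) (op γ c b)) ∧
  (∀ (a b : M) (γ : Γ), σ (op γ a b) (op γ b a)) ∧
  (∀ (a : M) (γ : Γ), σ (op γ a a) a)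

/-- The `σ`-class of `x`. -/
def cls (σ : M → M → Prop) (x : M) : Set M := {y | σ y x}

/-- `M` is a semilattice of simple semigroups. -/
def IsSemilatticeOfSimple [PartialOrder M] (op : Γ → M → M → M) : Prop :=
  ∃ σ : M → M → Prop, IsSemilatticeCong op σ ∧ ∀ x : M, IsSimpleSub op (cls σ x)

/-- `M` is a semilattice of left simple semigroups. -/
def IsSemilatticeOfLeftSimple [PartialOrder M] (op : Γ → M → M → M) : Prop :=
  ∃ σ : M → M → Prop, IsSemilatticeCong op σ ∧ ∀ x : M, IsLeftSimpleSub op (cls σ x)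

/-- `M` is a chain of simple semigroups. -/
def IsChainOfSimple [PartialOrder M] (op : Γ → M → M → M) : Prop :=
  ∃ σ : M → M → Prop, IsSemilatticeCong op σ ∧ (∀ x : M, IsSimpleSub op (cls σ x)) ∧
    ∀ (x y : M) (γ : Γ), cls σ x = cls σ (op γ x y) ∨ cls σ y = cls σ (op γ x y)


/-- `(MΓ{z}ΓM]`. -/
def twoSided [PartialOrder M] (op : Γ → M → M → M) (z : M) : Set M :=
  dcl (gprod op (gprod op Set.univ {z}) Set.univ)

theorem mem_twoSided [PartialOrder M] {op : Γ → M → M → M} {z t : M} :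
    t ∈ twoSided op z ↔ ∃ (a b : M) (α β : Γ), t ≤ op β (op α a z) b := by
  constructor
  · rintro ⟨_, ⟨_, ⟨a, -, _, rfl, α, rfl⟩, b, -, β, rfl⟩, h⟩
    exact ⟨a, b, α, β, h⟩
  · rintro ⟨a, b, α, β, h⟩
    exact ⟨_, ⟨_, ⟨a, trivial, z, rfl, α, rfl⟩, b, trivial, β, rfl⟩, h⟩

theorem isIdeal_twoSided [PartialOrder M] {op : Γ → M → M → M}
    (hM : IsPoGammaSemigroup op) (z : M) : IsIdeal op (twoSided op z) := by
  obtain ⟨assoc, mono_left, mono_right⟩ := hM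
  have down : ∀ a ∈ twoSided op z, ∀ b : M, b ≤ a → b ∈ twoSided op z := by
    rintro a ⟨h, hh, hah⟩ b hba
    exact ⟨h, hh, hba.trans hah⟩
  refine ⟨⟨?_, down⟩, ⟨?_, down⟩⟩
  · rintro _ ⟨c, -, t, ht, γ, rfl⟩
    obtain ⟨a, b, α, β, h⟩ := mem_twoSided.1 ht
    refine mem_twoSided.2 ⟨op γ c a, b, α, β, (mono_right _ _ c γ h).trans_eq ?_⟩
    simp only [assoc]
  · rintro _ ⟨t, ht, c, -, γ, rfl⟩
    obtain ⟨a, b, α, β, h⟩ := mem_twoSided.1 ht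
    refine mem_twoSided.2 ⟨a, op γ b c, α, β, (mono_left _ _ c γ h).trans_eq ?_⟩
    simp only [assoc]

theorem IsIntraRegular.mem_twoSided_self [PartialOrder M] [Nonempty Γ] {op : Γ → M → M → M}
    (hM : IsPoGammaSemigroup op) (hir : IsIntraRegular op) (x : M) : x ∈ twoSided op x := by
  obtain ⟨γ⟩ := ‹Nonempty Γ›
  obtain ⟨a, b, α, β, h⟩ := mem_twoSided.1 (hir x γ)
  refine mem_twoSided.2 ⟨a, op β x b, α, γ, h.trans_eq ?_⟩
  simp only [hM.1]

theorem IsIntraRegular.isSemiprimeSubset [PartialOrder M] {op : Γ → M → M → M}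
    (hir : IsIntraRegular op) {I : Set M} (hI : IsIdeal op I) : IsSemiprimeSubset op I := by
  intro z μ hz
  obtain ⟨a, b, α, β, h⟩ := mem_twoSided.1 (hir z μ)
  exact hI.1.2 _ (hI.2.1 ⟨_, hI.1.1 ⟨a, trivial, _, hz, α, rfl⟩, b, trivial, β, rfl⟩) _ h

/-- In an intra-regular po-Γ-semigroup, `MΓ{xγy}ΓM` absorbs insertions between `x` and `y`. -/
theorem IsIntraRegular.insert_mem_twoSided [PartialOrder M] {op : Γ → M → M → M}
    (hM : IsPoGammaSemigroup op) (hir : IsIntraRegular op) (x y c : M) (γ β δ : Γ) :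
    op δ (op β x c) y ∈ twoSided op (op γ x y) := by
  have hI := isIdeal_twoSided hM (op γ x y)
  have semiprime := hir.isSemiprimeSubset hI
  have swap : op γ y x ∈ twoSided op (op γ x y) := by
    refine semiprime _ γ (mem_twoSided.2 ⟨y, x, γ, γ, le_of_eq ?_⟩)
    simp only [hM.1]
  refine semiprime _ γ ?_
  have h := hI.2.1 ⟨_, hI.1.1 ⟨op β x c, trivial, _, swap, δ, rfl⟩,
    op δ c y, trivial, β, rfl⟩
  simpa only [hM.1] using h

theorem statement_13 [PartialOrder M] [Nonempty M] [Nonempty Γ]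
    (op : Γ → M → M → M) (hM : IsPoGammaSemigroup op)
    (hir : IsIntraRegular op)
    (hchain : ∀ A B : Set M, IsIdeal op A → IsIdeal op B → A ⊆ B ∨ B ⊆ A) :
    ∀ (x y : M) (γ : Γ),
      x ∈ dcl (gprod op (gprod op Set.univ {op γ x y}) Set.univ) ∨
      y ∈ dcl (gprod op (gprod op Set.univ {op γ x y}) Set.univ) := by
  intro x y γ
  change x ∈ twoSided op (op γ x y) ∨ y ∈ twoSided op (op γ x y)
  have hI := isIdeal_twoSided hM (op γ x y)
  have semiprime := hir.isSemiprimeSubset hI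
  rcases hchain _ _ (isIdeal_twoSided hM x) (isIdeal_twoSided hM y) with hxy | hyx
  · left
    obtain ⟨a, b, α, β, h⟩ := mem_twoSided.1 (hxy (hir.mem_twoSided_self hM x))
    refine semiprime x γ (hI.1.2 _ ?_ _ (hM.2.2 _ _ x γ h))
    have h' := hI.2.1 ⟨_, hir.insert_mem_twoSided hM x y a γ γ α, b, trivial, β, rfl⟩
    simpa only [hM.1] using h'
  · right
    obtain ⟨a, b, α, β, h⟩ := mem_twoSided.1 (hyx (hir.mem_twoSided_self hM y))
    refine semiprime y γ (hI.1.2 _ ?_ _ (hM.2.1 _ _ y γ h))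
    have h' := hI.1.1 ⟨a, trivial, _, hir.insert_mem_twoSided hM x y b γ β γ, α, rfl⟩
    simpa only [hM.1] using h'

end PGS
end

section
/- A po-Γ-semigroup M is intra-regular and the ideals of M form a chain (i.e., for any two ideals A, B of M, A ⊆ B or B ⊆ A) if and only if M is a chain of simple semigroups. -/
namespace PGS

variable {M : Type*} {Γ : Type*}

section

variable [PartialOrder M] {op : Γ → M → M → M}

lemma IsIdeal.op_left_mem {A : Set M} (hA : IsIdeal op A) {a : M} (ha : a ∈ A) (γ : Γ) (c : M) :
    op γ c a ∈ A :=
  hA.1.1 ⟨c, trivial, a, ha, γ, rfl⟩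

lemma IsIdeal.op_right_mem {A : Set M} (hA : IsIdeal op A) {a : M} (ha : a ∈ A) (γ : Γ) (c : M) :
    op γ a c ∈ A :=
  hA.2.1 ⟨a, ha, c, trivial, γ, rfl⟩

lemma IsIdeal.mem_of_le {A : Set M} (hA : IsIdeal op A) {a b : M} (ha : a ∈ A) (h : b ≤ a) :
    b ∈ A :=
  hA.1.2 a ha b h

lemma IsIdeal.inter_isIdealOfSub {A T : Set M} (hA : IsIdeal op A) (hT : IsSubsemigroup op T)
    (hne : (A ∩ T).Nonempty) : IsIdealOfSub op T (A ∩ T) := by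
  refine ⟨hne, Set.inter_subset_right, ?_, ?_, fun a ha b hb h => ⟨hA.mem_of_le ha.1 h, hb⟩⟩
  · rintro _ ⟨a, ha, b, hb, γ, rfl⟩
    exact ⟨hA.op_left_mem hb.1 γ a, hT.2 ⟨a, ha, b, hb.2, γ, rfl⟩⟩
  · rintro _ ⟨a, ha, b, hb, γ, rfl⟩
    exact ⟨hA.op_right_mem ha.1 γ b, hT.2 ⟨a, ha.2, b, hb, γ, rfl⟩⟩

/-- `(TΓ{c}ΓT]`, which is the ideal generated by `c` when `T = M` is intra-regular. -/
def sandwich (op : Γ → M → M → M) (T : Set M) (c : M) : Set M :=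
  {t | ∃ u ∈ T, ∃ v ∈ T, ∃ γ δ : Γ, t ≤ op γ u (op δ c v)}

lemma isIntraRegular_iff (hM : IsPoGammaSemigroup op) :
    IsIntraRegular op ↔ ∀ (x : M) (γ : Γ), x ∈ sandwich op Set.univ (op γ x x) := by
  refine forall₂_congr fun x γ => ⟨?_, ?_⟩
  · rintro ⟨_, ⟨_, ⟨u, -, _, rfl, α, rfl⟩, v, -, β, rfl⟩, h⟩
    exact ⟨u, trivial, v, trivial, α, β, by rwa [hM.1 u] at h⟩
  · rintro ⟨u, -, v, -, α, β, h⟩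
    exact ⟨_, ⟨_, ⟨u, trivial, _, rfl, α, rfl⟩, v, trivial, β, rfl⟩, by rwa [hM.1 u]⟩

lemma sandwich_op_left_mem (hM : IsPoGammaSemigroup op) {T : Set M} (hT : gprod op T T ⊆ T)
    {a c t : M} (ha : a ∈ T) (ht : t ∈ sandwich op T c) (γ : Γ) :
    op γ a t ∈ sandwich op T c := by
  obtain ⟨u, hu, v, hv, α, β, h⟩ := ht
  refine ⟨op γ a u, hT ⟨a, ha, u, hu, γ, rfl⟩, v, hv, α, β, ?_⟩
  rw [hM.1]
  exact hM.2.2 _ _ _ _ h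

lemma sandwich_op_right_mem (hM : IsPoGammaSemigroup op) {T : Set M} (hT : gprod op T T ⊆ T)
    {a c t : M} (ha : a ∈ T) (ht : t ∈ sandwich op T c) (γ : Γ) :
    op γ t a ∈ sandwich op T c := by
  obtain ⟨u, hu, v, hv, α, β, h⟩ := ht
  refine ⟨u, hu, op γ v a, hT ⟨v, hv, a, ha, γ, rfl⟩, α, β, ?_⟩
  have := hM.2.1 _ _ a γ h
  simpa only [hM.1] using this

lemma isIdeal_sandwich_univ (hM : IsPoGammaSemigroup op) (c : M) :
    IsIdeal op (sandwich op Set.univ c) := by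
  have hd : ∀ a ∈ sandwich op Set.univ c, ∀ b : M, b ≤ a → b ∈ sandwich op Set.univ c := by
    rintro a ⟨u, hu, v, hv, α, β, h⟩ b hb
    exact ⟨u, hu, v, hv, α, β, hb.trans h⟩
  refine ⟨⟨?_, hd⟩, ⟨?_, hd⟩⟩
  · rintro _ ⟨a, ha, b, hb, γ, rfl⟩
    exact sandwich_op_left_mem hM (Set.subset_univ _) ha hb γ
  · rintro _ ⟨a, ha, b, hb, γ, rfl⟩
    exact sandwich_op_right_mem hM (Set.subset_univ _) hb ha γ

lemma IsIdeal.sandwich_subset {A : Set M} (hA : IsIdeal op A) {c : M} (hc : c ∈ A) :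
    sandwich op Set.univ c ⊆ A := by
  rintro t ⟨u, -, v, -, α, β, h⟩
  exact hA.mem_of_le (hA.op_left_mem (hA.op_right_mem hc β v) α u) h

lemma IsSimpleSub.sandwich_inter_eq [Nonempty Γ] (hM : IsPoGammaSemigroup op) {T : Set M}
    (hT : IsSimpleSub op T) {c : M} (hc : c ∈ T) : sandwich op T c ∩ T = T := by
  have hTT := hT.1.2
  obtain ⟨γ⟩ := ‹Nonempty Γ›
  refine hT.2 _ ⟨⟨op γ c (op γ c c), ⟨c, hc, c, hc, γ, γ, le_rfl⟩, ?_⟩,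
    Set.inter_subset_right, ?_, ?_, ?_⟩
  · exact hTT ⟨c, hc, _, hTT ⟨c, hc, c, hc, γ, rfl⟩, γ, rfl⟩
  · rintro _ ⟨a, ha, b, hb, δ, rfl⟩
    exact ⟨sandwich_op_left_mem hM hTT ha hb.1 δ, hTT ⟨a, ha, b, hb.2, δ, rfl⟩⟩
  · rintro _ ⟨a, ha, b, hb, δ, rfl⟩
    exact ⟨sandwich_op_right_mem hM hTT hb ha.1 δ, hTT ⟨a, ha.2, b, hb, δ, rfl⟩⟩
  · rintro a ⟨⟨u, hu, v, hv, α, β, h⟩, -⟩ b hb hle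
    exact ⟨⟨u, hu, v, hv, α, β, hle.trans h⟩, hb⟩

lemma IsIntraRegular.isSemiprimeSubset_s14 (hM : IsPoGammaSemigroup op) (hI : IsIntraRegular op)
    {A : Set M} (hA : IsIdeal op A) : IsSemiprimeSubset op A := fun a γ h =>
  hA.sandwich_subset h ((isIntraRegular_iff hM).1 hI a γ)

lemma IsIntraRegular.mem_sandwich_self [Nonempty Γ] (hM : IsPoGammaSemigroup op)
    (hI : IsIntraRegular op) (a : M) : a ∈ sandwich op Set.univ a := by
  obtain ⟨γ⟩ := ‹Nonempty Γ›
  obtain ⟨u, -, v, -, α, β, h⟩ := (isIntraRegular_iff hM).1 hI a γ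
  exact ⟨u, trivial, op β a v, trivial, α, γ, by rwa [hM.1] at h⟩

lemma IsIntraRegular.op_op_mem (hM : IsPoGammaSemigroup op) (hI : IsIntraRegular op)
    {A : Set M} (hA : IsIdeal op A) {a b : M} {γ : Γ} (h : op γ a b ∈ A) (μ ν : Γ) (z : M) :
    op μ b (op ν z a) ∈ A := by
  refine hI.isSemiprimeSubset_s14 hM hA _ γ ?_
  have h' := hA.op_left_mem (hA.op_left_mem (hA.op_right_mem h μ (op ν z a)) ν z) μ b
  simpa only [hM.1] using h'

lemma IsIntraRegular.sandwich_op [Nonempty Γ] (hM : IsPoGammaSemigroup op)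
    (hI : IsIntraRegular op) (γ : Γ) (a b : M) :
    sandwich op Set.univ (op γ a b) = sandwich op Set.univ a ∩ sandwich op Set.univ b := by
  have hJ := isIdeal_sandwich_univ hM
  have hm := hI.mem_sandwich_self hM
  refine subset_antisymm (Set.subset_inter ((hJ a).sandwich_subset ((hJ a).op_right_mem (hm a) γ b))
    ((hJ b).sandwich_subset ((hJ b).op_left_mem (hm b) γ a))) ?_
  rintro t ⟨⟨u, -, v, -, α, β, h₁⟩, ⟨w, -, z, -, α', β', h₂⟩⟩
  have hc := hJ (op γ a b)
  refine hI.isSemiprimeSubset_s14 hM hc t γ (hc.mem_of_le ?_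
    ((hM.2.1 _ _ t γ h₂).trans (hM.2.2 _ _ _ γ h₁)))
  have h := hI.op_op_mem hM hc (hm (op γ a b)) β' α (op γ z u)
  have h' := hc.op_left_mem (hc.op_right_mem h β v) α' w
  simpa only [hM.1] using h'

lemma IsIntraRegular.isSimpleSub_cls [Nonempty Γ] (hM : IsPoGammaSemigroup op)
    (hI : IsIntraRegular op) (x : M) :
    IsSimpleSub op
      (cls (fun a b => sandwich op Set.univ a = sandwich op Set.univ b) x) := by
  have hJ := isIdeal_sandwich_univ hM
  have hm := hI.mem_sandwich_self hM
  have hop := hI.sandwich_op hM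
  refine ⟨⟨⟨x, rfl⟩, ?_⟩, fun I ⟨⟨a, ha⟩, hIT, hl, hr, hd⟩ => hIT.antisymm fun b hb => ?_⟩
  · rintro _ ⟨a, ha, b, hb, γ, rfl⟩
    change sandwich op Set.univ a = _ at ha
    change sandwich op Set.univ b = _ at hb
    change sandwich op Set.univ _ = _
    rw [hop, ha, hb, Set.inter_self]
  have haT : sandwich op Set.univ a = sandwich op Set.univ x := hIT ha
  have hbT : sandwich op Set.univ b = sandwich op Set.univ x := hb
  obtain ⟨γ⟩ := ‹Nonempty Γ›
  have hmem : b ∈ sandwich op Set.univ (op γ a (op γ a a)) := by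
    rw [hop, hop, Set.inter_self, Set.inter_self, haT, ← hbT]
    exact hm b
  obtain ⟨u, -, v, -, α, β, h⟩ := hmem
  have hsub := (hJ _).sandwich_subset ((hJ _).mem_of_le (hm _) h)
  simp only [hop, hbT, haT] at hsub
  have hu : op α u a ∈ cls (fun a b => sandwich op Set.univ a = sandwich op Set.univ b) x := by
    change sandwich op Set.univ _ = _
    rw [hop, haT]
    exact Set.inter_eq_right.2 fun t ht => (hsub ht).1
  have hv : op β a v ∈ cls (fun a b => sandwich op Set.univ a = sandwich op Set.univ b) x := by
    change sandwich op Set.univ _ = _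
    rw [hop, haT]
    exact Set.inter_eq_left.2 fun t ht => (hsub ht).2.2
  refine hd _ (hl ⟨_, hu, _, hr ⟨a, ha, _, hv, γ, rfl⟩, γ, rfl⟩) b hb ?_
  simpa only [hM.1] using h

end

theorem statement_14 [PartialOrder M] [Nonempty M] [Nonempty Γ]
    (op : Γ → M → M → M) (hM : IsPoGammaSemigroup op) :
    (IsIntraRegular op ∧
        ∀ A B : Set M, IsIdeal op A → IsIdeal op B → A ⊆ B ∨ B ⊆ A) ↔
      IsChainOfSimple op := by
  constructor
  · rintro ⟨hI, hchain⟩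
    have hop := hI.sandwich_op hM
    refine ⟨fun a b => sandwich op Set.univ a = sandwich op Set.univ b,
      ⟨⟨fun _ => rfl, fun h => h.symm, fun h h' => h.trans h'⟩, ?_, ?_, ?_, ?_⟩,
      hI.isSimpleSub_cls hM, ?_⟩
    · intro a b c γ h
      simp only [hop, h]
    · intro a b c γ h
      simp only [hop, h]
    · intro a b γ
      simp only [hop, Set.inter_comm]
    · intro a γ
      simp only [hop, Set.inter_self]
    · intro x y γ
      simp only [cls, hop]
      rcases hchain _ _ (isIdeal_sandwich_univ hM x) (isIdeal_sandwich_univ hM y) with h | h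
      · exact Or.inl (by rw [Set.inter_eq_left.2 h])
      · exact Or.inr (by rw [Set.inter_eq_right.2 h])
  · rintro ⟨σ, ⟨hσ, -, -, -, hsq⟩, hsimple, hchain⟩
    refine ⟨(isIntraRegular_iff hM).2 fun x γ => ?_, fun A B hA hB => ?_⟩
    · have hx : x ∈ sandwich op (cls σ x) (op γ x x) ∩ cls σ x := by
        rw [(hsimple x).sandwich_inter_eq hM (hsq x γ)]
        exact hσ.refl x
      obtain ⟨⟨u, -, v, -, α, β, h⟩, -⟩ := hx
      exact ⟨u, trivial, v, trivial, α, β, h⟩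
    · have key : ∀ C : Set M, IsIdeal op C → ∀ x y : M, y ∈ C → cls σ x = cls σ y → x ∈ C := by
        intro C hC x y hy hxy
        have hyx : y ∈ cls σ x := hxy ▸ hσ.refl y
        have hCx := (hsimple x).2 _ (hC.inter_isIdealOfSub (hsimple x).1 ⟨y, hy, hyx⟩)
        exact Set.inter_eq_right.1 hCx (hσ.refl x)
      rw [or_iff_not_imp_left, Set.not_subset]
      rintro ⟨a, ha, haB⟩ b hb
      obtain ⟨γ⟩ := ‹Nonempty Γ›
      rcases hchain a b γ with h | h
      · exact absurd (key B hB a _ (hB.op_left_mem hb γ a) h) haB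
      · exact key A hA b _ (hA.op_right_mem ha γ b) h

end PGS
end
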